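/- Let p ≥ 1 and k ≥ 1 be integers and let q₁, q₂ be integers with 0 ≤ q₁ ≤ p−1 and 0 ≤ q₂ ≤ p−1. Place equally spaced knots s_i = i/k (i = 0,…,k) on [0,1], and for each order m ≥ 1 let φ_i^{(m)} be the order-m O-spline basis function with these knots (φ_i^{(m)}(x) = 0 for x ≤ s_{i−1}; (x−s_{i−1})^m/m! for s_{i−1} < x ≤ s_i; ((x−s_{i−1})^m − (x−s_i)^m)/m! for x > s_i). Then sup over s, t ∈ [0,1] of | ∫₀^{min(s,t)} (s−u)^{p−1−q₁}(t−u)^{p−1−q₂} / ((p−1−q₁)!·(p−1−q₂)!) du − k·Σ_{i=1}^k φ_i^{(p−q₁)}(s)·φ_i^{(p−q₂)}(t) | ≤ 2/k. (The first term is the cross-covariance C^{(q₁,q₂)}(s,t) = Cov[g^{(q₁)}(s), g^{(q₂)}(t)] of the derivatives of the p-th order integrated Wiener process g with σ = 1; the second is the corresponding cross-covariance of the derivatives of the O-spline approximation; so ||C^{(q₁,q₂)} − C_k^{(q₁,q₂)}||_∞ = O(1/k) for all derivative orders up to p−1.) -/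

import Mathlib

open MeasureTheory Finset

/-- The order-`m` O-spline basis function with equally spaced knots `s_i = i/k` on `[0,1]`,
associated to the knot interval `(s_{i-1}, s_i]`. -/
noncomputable def ospline (m k i : ℕ) (x : ℝ) : ℝ :=
  if x ≤ ((i : ℝ) - 1) / k then 0
  else if x ≤ (i : ℝ) / k then (x - ((i : ℝ) - 1) / k) ^ m / (Nat.factorial m)
  else ((x - ((i : ℝ) - 1) / k) ^ m - (x - (i : ℝ) / k) ^ m) / (Nat.factorial m)

/-- Truncated power kernel. -/
noncomputable def tpow (a : ℕ) (s u : ℝ) : ℝ :=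
  if u < s then (s - u) ^ a / (Nat.factorial a) else 0

lemma tpow_nonneg (a : ℕ) (s u : ℝ) : 0 ≤ tpow a s u := by
  unfold tpow
  split_ifs with h
  · have : 0 ≤ s - u := by linarith
    positivity
  · exact le_rfl

lemma tpow_antitone (a : ℕ) (s : ℝ) : Antitone (tpow a s) := by
  intro u v huv
  by_cases hv : v < s
  · have hu : u < s := lt_of_le_of_lt huv hv
    have h0 : 0 ≤ s - v := by linarith
    simp only [tpow, hv, hu, if_true]
    gcongr
  · have : tpow a s v = 0 := by simp [tpow, hv]
    rw [this]
    exact tpow_nonneg a s u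

lemma tpow_zero_le (a : ℕ) (s : ℝ) (hs : s ≤ 1) : tpow a s 0 ≤ 1 := by
  unfold tpow
  split_ifs with h
  · rw [sub_zero]
    have h1 : s ^ a ≤ 1 := pow_le_one₀ h.le hs
    have h2 : (1 : ℝ) ≤ (Nat.factorial a : ℝ) := by exact_mod_cast Nat.factorial_pos a
    rw [div_le_one (by positivity)]
    linarith
  · exact zero_le_one

lemma pow_diff_bounds (a : ℕ) (x y : ℝ) (hy : 0 ≤ y) (hxy : y ≤ x) :
    (a + 1 : ℝ) * y ^ a * (x - y) ≤ x ^ (a + 1) - y ^ (a + 1) ∧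
    x ^ (a + 1) - y ^ (a + 1) ≤ (a + 1 : ℝ) * x ^ a * (x - y) := by
  induction a with
  | zero => simp
  | succ n ih =>
    obtain ⟨h1, h2⟩ := ih
    have hx : 0 ≤ x := hy.trans hxy
    have hp : y ^ (n + 1) ≤ x ^ (n + 1) := by gcongr
    have hd : 0 ≤ x - y := by linarith
    have e1 := mul_le_mul_of_nonneg_left h1 hy
    have e2 := mul_le_mul_of_nonneg_left h2 hx
    have e3 := mul_le_mul_of_nonneg_right hp hd
    push_cast
    constructor
    · have : x ^ (n + 1 + 1) - y ^ (n + 1 + 1)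
        = y * (x ^ (n + 1) - y ^ (n + 1)) + x ^ (n + 1) * (x - y) := by ring
      rw [this]
      have : ((n : ℝ) + 1 + 1) * y ^ (n + 1) * (x - y)
        = y * (((n : ℝ) + 1) * y ^ n * (x - y)) + y ^ (n + 1) * (x - y) := by ring
      rw [this]
      linarith
    · have : x ^ (n + 1 + 1) - y ^ (n + 1 + 1)
        = x * (x ^ (n + 1) - y ^ (n + 1)) + y ^ (n + 1) * (x - y) := by ring
      rw [this]
      have : ((n : ℝ) + 1 + 1) * x ^ (n + 1) * (x - y)
        = x * (((n : ℝ) + 1) * x ^ n * (x - y)) + x ^ (n + 1) * (x - y) := by ring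
      rw [this]
      linarith

lemma ospline_bounds (a k j : ℕ) (hk : 1 ≤ k) (s : ℝ) :
    tpow a s ((j + 1 : ℕ) / (k : ℝ)) / k ≤ ospline (a + 1) k (j + 1) s ∧
    ospline (a + 1) k (j + 1) s ≤ tpow a s ((j : ℝ) / k) / k := by
  have hk0 : (0 : ℝ) < k := by exact_mod_cast hk
  have hF : (0 : ℝ) < (Nat.factorial a : ℝ) := by exact_mod_cast Nat.factorial_pos a
  have hfac : (Nat.factorial (a + 1) : ℝ) = (a + 1 : ℝ) * (Nat.factorial a : ℝ) := by
    rw [Nat.factorial_succ]; push_cast; ring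
  have hstep : (((j + 1 : ℕ) : ℝ)) / k = (j : ℝ) / k + 1 / k := by push_cast; ring
  have hinv : (0 : ℝ) < 1 / k := by positivity
  have ha : (0 : ℝ) < (a : ℝ) + 1 := by positivity
  have hj : (((j + 1 : ℕ) : ℝ) - 1) / k = (j : ℝ) / k := by push_cast; ring
  unfold ospline
  rw [hj, hstep, hfac]
  generalize (j : ℝ) / k = b at *
  split_ifs with h1 h2
  · have h3 : ¬ (b + 1 / k < s) := by linarith
    have h4 : ¬ (b < s) := by linarith
    simp only [tpow, h3, h4, if_false, zero_div, le_refl, and_self]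
  · have h3 : ¬ (b + 1 / k < s) := by linarith
    have h4 : b < s := by linarith
    simp only [tpow, h3, h4, if_true, if_false]
    have hx : 0 ≤ s - b := by linarith
    constructor
    · rw [zero_div]; positivity
    · rw [div_le_iff₀ (by positivity)]
      have : (s - b) ^ a / (Nat.factorial a : ℝ) / k * (((a : ℝ) + 1) * (Nat.factorial a : ℝ))
        = (s - b) ^ a * ((1 / k) * ((a : ℝ) + 1)) := by field_simp
      rw [this, pow_succ]
      apply mul_le_mul_of_nonneg_left _ (by positivity)
      have h5 : s - b ≤ 1 / k := by linarith
      have : (0 : ℝ) ≤ a := by positivity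
      nlinarith
  · have h3 : (b + 1 / k < s) := by linarith
    have h4 : b < s := by linarith
    simp only [tpow, h3, h4, if_true]
    obtain ⟨e1, e2⟩ := pow_diff_bounds a (s - b) (s - (b + 1 / k)) (by linarith) (by linarith)
    have hd : (s - b) - (s - (b + 1 / k)) = 1 / k := by ring
    rw [hd] at e1 e2
    constructor
    · rw [le_div_iff₀ (by positivity)]
      refine le_trans (le_of_eq ?_) e1
      field_simp
    · rw [div_le_iff₀ (by positivity)]
      refine le_trans e2 (le_of_eq ?_)
      field_simp

lemma piece_bounds (H : ℝ → ℝ) (hH : Antitone H) (x y : ℝ) (hxy : x ≤ y) :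
    H y * (y - x) ≤ ∫ u in x..y, H u ∧ ∫ u in x..y, H u ≤ H x * (y - x) := by
  have hi : IntervalIntegrable H volume x y := hH.intervalIntegrable
  constructor
  · have := intervalIntegral.integral_mono_on hxy
      (intervalIntegrable_const (c := H y)) hi (fun u hu => hH hu.2)
    simpa [mul_comm] using this
  · have := intervalIntegral.integral_mono_on hxy hi
      (intervalIntegrable_const (c := H x)) (fun u hu => hH hu.1)
    simpa [mul_comm] using this

lemma main_aux (a b k : ℕ) (hk : 1 ≤ k)
    (s t : ℝ) (hs : s ∈ Set.Icc (0 : ℝ) 1) (ht : t ∈ Set.Icc (0 : ℝ) 1) :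
    |(∫ u in (0 : ℝ)..min s t,
        (s - u) ^ a * (t - u) ^ b /
          ((Nat.factorial a : ℝ) * (Nat.factorial b : ℝ))) -
      (k : ℝ) * ∑ i ∈ Finset.Icc 1 k, ospline (a + 1) k i s * ospline (b + 1) k i t| ≤ 1 / k := by
  have hk0 : (0 : ℝ) < k := by exact_mod_cast hk
  set H : ℝ → ℝ := fun u => tpow a s u * tpow b t u with hHdef
  have hH : Antitone H := fun u v huv =>
    mul_le_mul (tpow_antitone a s huv) (tpow_antitone b t huv) (tpow_nonneg _ _ _) (tpow_nonneg _ _ _)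
  have hHi : ∀ x y, IntervalIntegrable H volume x y := fun x y => hH.intervalIntegrable
  have hm0 : 0 ≤ min s t := le_min hs.1 ht.1
  have hm1 : min s t ≤ 1 := (min_le_left _ _).trans hs.2
  have hint : (∫ u in (0 : ℝ)..min s t,
        (s - u) ^ a * (t - u) ^ b /
          ((Nat.factorial a : ℝ) * (Nat.factorial b : ℝ))) = ∫ u in (0 : ℝ)..1, H u := by
    rw [← intervalIntegral.integral_add_adjacent_intervals (hHi 0 (min s t)) (hHi (min s t) 1)]
    have hz : ∫ u in (min s t)..1, H u = 0 := by
      rw [intervalIntegral.integral_congr (g := fun _ => (0 : ℝ))]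
      · simp
      · intro u hu
        rw [Set.uIcc_of_le hm1] at hu
        rcases min_le_iff.1 hu.1 with h | h
        · simp [hHdef, tpow, not_lt.2 h]
        · simp [hHdef, tpow, not_lt.2 h]
    rw [hz, add_zero]
    rw [intervalIntegral.integral_of_le hm0, intervalIntegral.integral_of_le hm0,
      MeasureTheory.integral_Ioc_eq_integral_Ioo, MeasureTheory.integral_Ioc_eq_integral_Ioo]
    apply MeasureTheory.setIntegral_congr_fun measurableSet_Ioo
    intro u hu
    have h1 : u < s := hu.2.trans_le (min_le_left _ _)
    have h2 : u < t := hu.2.trans_le (min_le_right _ _)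
    simp only [hHdef, tpow, h1, h2, if_true]
    rw [div_mul_div_comm]
  have hsplit : ∫ u in (0 : ℝ)..1, H u
      = ∑ j ∈ Finset.range k, ∫ u in ((j : ℝ) / k)..(((j + 1 : ℕ) : ℝ) / k), H u := by
    rw [intervalIntegral.sum_integral_adjacent_intervals (a := fun j : ℕ => (j : ℝ) / k)
      (fun j _ => hHi _ _)]
    simp [hk0.ne']
  have hre : ∑ i ∈ Finset.Icc 1 k, ospline (a + 1) k i s * ospline (b + 1) k i t
      = ∑ j ∈ Finset.range k, ospline (a + 1) k (j + 1) s * ospline (b + 1) k (j + 1) t := by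
    rw [Finset.range_eq_Ico, Finset.sum_Ico_add'
      (fun i => ospline (a + 1) k i s * ospline (b + 1) k i t)]
    rfl
  rw [hint, hsplit, hre, Finset.mul_sum, ← Finset.sum_sub_distrib]
  have hterm : ∀ j ∈ Finset.range k,
      |(∫ u in ((j : ℝ) / k)..(((j + 1 : ℕ) : ℝ) / k), H u)
        - k * (ospline (a + 1) k (j + 1) s * ospline (b + 1) k (j + 1) t)|
      ≤ H ((j : ℝ) / k) / k - H (((j + 1 : ℕ) : ℝ) / k) / k := by
    intro j _
    have hd : (((j + 1 : ℕ) : ℝ)) / k - (j : ℝ) / k = 1 / k := by push_cast; ring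
    have hle : (j : ℝ) / k ≤ ((j + 1 : ℕ) : ℝ) / k := by
      have : (0 : ℝ) < 1 / k := by positivity
      linarith
    obtain ⟨p1, p2⟩ := piece_bounds H hH _ _ hle
    rw [hd, mul_one_div] at p1 p2
    obtain ⟨a1, a2⟩ := ospline_bounds a k j hk s
    obtain ⟨b1, b2⟩ := ospline_bounds b k j hk t
    have na := tpow_nonneg a s (((j + 1 : ℕ) : ℝ) / k)
    have nb := tpow_nonneg b t (((j + 1 : ℕ) : ℝ) / k)
    have na' := tpow_nonneg a s ((j : ℝ) / k)
    have nb' := tpow_nonneg b t ((j : ℝ) / k)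
    have oa : 0 ≤ ospline (a + 1) k (j + 1) s := le_trans (by positivity) a1
    have ob : 0 ≤ ospline (b + 1) k (j + 1) t := le_trans (by positivity) b1
    have l1 := mul_le_mul_of_nonneg_left (mul_le_mul a1 b1 (by positivity) oa) hk0.le
    have l2 := mul_le_mul_of_nonneg_left (mul_le_mul a2 b2 ob (by positivity)) hk0.le
    have hsimp : ∀ x y : ℝ, (k : ℝ) * (x / k * (y / k)) = x * y / k := by
      intro x y; field_simp
    rw [hsimp] at l1 l2
    simp only [hHdef] at p1 p2 ⊢
    rw [abs_le]
    constructor <;> linarith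
  refine (Finset.abs_sum_le_sum_abs _ _).trans ((Finset.sum_le_sum hterm).trans ?_)
  rw [Finset.sum_range_sub' (fun j : ℕ => H ((j : ℝ) / k) / k)]
  have h0 : H 0 ≤ 1 := mul_le_one₀ (tpow_zero_le a s hs.2) (tpow_nonneg _ _ _)
    (tpow_zero_le b t ht.2)
  have h1 : 0 ≤ H ((k : ℝ) / k) := mul_nonneg (tpow_nonneg _ _ _) (tpow_nonneg _ _ _)
  have h2 : 0 ≤ H ((k : ℝ) / k) / k := by positivity
  have h3 : H 0 / k ≤ 1 / k := by gcongr
  simp only [Nat.cast_zero, zero_div]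
  linarith

/-- Main Theorem (Theorem 1) on `Ω = [0,1]`: for all derivative orders `q₁, q₂ ≤ p - 1`, the
cross-covariance of the derivatives of the order-`p` O-spline approximation,
`k ∑ φ_i^{(p-q₁)}(s) φ_i^{(p-q₂)}(t)`, is uniformly within `2/k` of the cross-covariance
`∫₀^{min(s,t)} (s-u)^{p-1-q₁}(t-u)^{p-1-q₂}/((p-1-q₁)!(p-1-q₂)!) du` of the corresponding
derivatives of the `p`-th order integrated Wiener process with `σ = 1`. -/
theorem ospline_main_theorem (p k : ℕ) (hp : 1 ≤ p) (hk : 1 ≤ k)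
    (q₁ q₂ : ℕ) (hq₁ : q₁ ≤ p - 1) (hq₂ : q₂ ≤ p - 1)
    (s t : ℝ) (hs : s ∈ Set.Icc (0 : ℝ) 1) (ht : t ∈ Set.Icc (0 : ℝ) 1) :
    |(∫ u in (0 : ℝ)..min s t,
        (s - u) ^ (p - 1 - q₁) * (t - u) ^ (p - 1 - q₂) /
          ((Nat.factorial (p - 1 - q₁) : ℝ) * (Nat.factorial (p - 1 - q₂) : ℝ))) -
      (k : ℝ) * ∑ i ∈ Finset.Icc 1 k, ospline (p - q₁) k i s * ospline (p - q₂) k i t| ≤ 2 / k := by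
  have hk0 : (0 : ℝ) < k := by exact_mod_cast hk
  have h := main_aux (p - 1 - q₁) (p - 1 - q₂) k hk s t hs ht
  have e1 : p - 1 - q₁ + 1 = p - q₁ := by omega
  have e2 : p - 1 - q₂ + 1 = p - q₂ := by omega
  rw [e1, e2] at h
  refine h.trans ?_
  gcongr
  norm_num
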